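/- Let M ≥ 2 be an integer, let F^C, F^S ∈ ℝ^{M×M} be the DCT and DST matrices, let b = (M−1)² and a = 2M² − 2b, and let W ∈ ℝ^{2M²×2M²} be the block-diagonal matrix W = diag((1/√2)·I_a, (1/2)·[[I_b, −I_b],[I_b, I_b]]). Then for every permutation matrix P ∈ ℝ^{2M²×2M²}, the DADCF analysis operator F^D = Pᵀ W P [F^C⊗F^C ; F^S⊗F^S] ∈ ℝ^{2M²×M²} satisfies (F^D)ᵀ F^D = I_{M²}, i.e., the DADCF is a Parseval frame. -/

import Mathlib

open Matrix

/-- The `(k,n)` entry of the type-II DCT matrix `F^C ∈ ℝ^{M×M}`. -/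
noncomputable def dctEntry (M k n : ℕ) : ℝ :=
  (if k = 0 then 1 / Real.sqrt 2 else 1) * Real.sqrt (2 / M) *
    Real.cos (Real.pi / M * k * (n + 1 / 2))

/-- The `(k,n)` entry of the (row-permuted type-II) DST matrix `F^S ∈ ℝ^{M×M}`. -/
noncomputable def dstEntry (M k n : ℕ) : ℝ :=
  if k = 0 then Real.sqrt (1 / M) * Real.sin (Real.pi * (n + 1 / 2))
  else Real.sqrt (2 / M) * Real.sin (Real.pi / M * k * (n + 1 / 2))

/-- Entry `(r,c)` of the Kronecker product `F ⊗ F` of an `M×M` matrix with itself,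
with both indices flattened to `{0,…,M²−1}` via `r ↦ (r / M, r % M)`. -/
noncomputable def kron2 (f : ℕ → ℕ → ℝ) (M r c : ℕ) : ℝ :=
  f (r / M) (c / M) * f (r % M) (c % M)

/-- The vertically stacked matrix `[F^C ⊗ F^C ; F^S ⊗ F^S] ∈ ℝ^{2M² × M²}`. -/
noncomputable def dadcfStack (M : ℕ) : Matrix (Fin (2 * M ^ 2)) (Fin (M ^ 2)) ℝ :=
  Matrix.of fun i p =>
    if (i : ℕ) < M ^ 2 then kron2 (dctEntry M) M (i : ℕ) (p : ℕ)
    else kron2 (dstEntry M) M ((i : ℕ) - M ^ 2) (p : ℕ)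

/-- The block-diagonal weighting matrix
`W = diag((1/√2)·I_a, (1/2)·[[I_b, −I_b],[I_b, I_b]]) ∈ ℝ^{2M²×2M²}`,
where `b = (M−1)²` and `a = 2M² − 2b`. -/
noncomputable def dadcfW (M : ℕ) : Matrix (Fin (2 * M ^ 2)) (Fin (2 * M ^ 2)) ℝ :=
  Matrix.of fun i j =>
    let b := (M - 1) ^ 2
    let a := 2 * M ^ 2 - 2 * b
    if (i : ℕ) < a then (if (i : ℕ) = (j : ℕ) then 1 / Real.sqrt 2 else 0)
    else if (j : ℕ) < a then 0
    else
      (1 / 2) *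
        (if (i : ℕ) = (j : ℕ) then 1
          else if (i : ℕ) - a + b = (j : ℕ) - a then -1
          else if (i : ℕ) - a = (j : ℕ) - a + b then 1
          else 0)

lemma dadcf_dirichlet (x : ℝ) (N : ℕ) :
    Real.sin (x / 2) * (1 + 2 * ∑ k ∈ Finset.range N, Real.cos (((k + 1 : ℕ) : ℝ) * x))
      = Real.sin ((N + 1 / 2) * x) := by
  induction N with
  | zero => simp; ring_nf
  | succ N ih =>
    rw [Finset.sum_range_succ]
    have h1 : Real.sin (((N + 1 : ℕ) + 1 / 2 : ℝ) * x) = Real.sin (((N + 1 : ℕ) : ℝ) * x + x / 2) := by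
      congr 1; ring
    have h2 : Real.sin ((N + 1 / 2 : ℝ) * x) = Real.sin (((N + 1 : ℕ) : ℝ) * x - x / 2) := by
      congr 1; push_cast; ring
    rw [h1]
    rw [h2] at ih
    rw [Real.sin_add]
    rw [Real.sin_sub] at ih
    linear_combination ih

/-- value of the Dirichlet sum at `π j / M`, `M = N + 1`. -/
lemma dadcf_D (N : ℕ) (j : ℕ) (h0 : 0 < j) (h1 : j < 2 * (N + 1)) :
    1 + 2 * ∑ k ∈ Finset.range N,
      Real.cos (((k + 1 : ℕ) : ℝ) * (Real.pi / ((N + 1 : ℕ) : ℝ) * j)) = - (-1) ^ j := by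
  have hM : (0 : ℝ) < ((N + 1 : ℕ) : ℝ) := by positivity
  have hj : (0 : ℝ) < j := by exact_mod_cast h0
  have hj2 : (j : ℝ) < 2 * ((N + 1 : ℕ) : ℝ) := by exact_mod_cast h1
  have hd := dadcf_dirichlet (Real.pi / ((N + 1 : ℕ) : ℝ) * j) N
  have hs : 0 < Real.sin (Real.pi / ((N + 1 : ℕ) : ℝ) * j / 2) := by
    apply Real.sin_pos_of_pos_of_lt_pi
    · have := Real.pi_pos; positivity
    · rw [div_mul_eq_mul_div, div_div, div_lt_iff₀ (by positivity)]
      nlinarith [Real.pi_pos]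
  have he : ((N : ℝ) + 1 / 2) * (Real.pi / ((N + 1 : ℕ) : ℝ) * j)
      = j * Real.pi - Real.pi / ((N + 1 : ℕ) : ℝ) * j / 2 := by
    have hN : (N : ℝ) = ((N + 1 : ℕ) : ℝ) - 1 := by push_cast; ring
    rw [hN]; field_simp; ring
  rw [he, Real.sin_sub, Real.sin_nat_mul_pi, Real.cos_nat_mul_pi] at hd
  apply mul_left_cancel₀ hs.ne'
  rw [hd]; ring

lemma dadcf_D0 (N : ℕ) :
    1 + 2 * ∑ k ∈ Finset.range N,
      Real.cos (((k + 1 : ℕ) : ℝ) * (Real.pi / ((N + 1 : ℕ) : ℝ) * ((0 : ℕ) : ℝ))) = 2 * N + 1 := by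
  simp; ring

lemma dadcf_sin_half (n : ℕ) : Real.sin (Real.pi * (n + 1 / 2)) = (-1) ^ n := by
  have : Real.pi * (n + 1 / 2) = n * Real.pi + Real.pi / 2 := by ring
  rw [this, Real.sin_add_pi_div_two, Real.cos_nat_mul_pi]

lemma dadcf_cc (N n d : ℕ) : ∑ k ∈ Finset.range (N + 1), dctEntry (N + 1) k n * dctEntry (N + 1) k (n + d)
    = 1 / ((N + 1 : ℕ) : ℝ) * (1 / 2 * (1 + 2 * ∑ k ∈ Finset.range N,
      Real.cos (((k + 1 : ℕ) : ℝ) * (Real.pi / ((N + 1 : ℕ) : ℝ) * (d : ℕ))))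
      + 1 / 2 * (1 + 2 * ∑ k ∈ Finset.range N,
      Real.cos (((k + 1 : ℕ) : ℝ) * (Real.pi / ((N + 1 : ℕ) : ℝ) * ((2 * n + d + 1 : ℕ) : ℝ))))) := by
  have hM : (0 : ℝ) < ((N + 1 : ℕ) : ℝ) := by positivity
  rw [Finset.sum_range_succ']
  have e0 : dctEntry (N + 1) 0 n * dctEntry (N + 1) 0 (n + d) = 1 / ((N + 1 : ℕ) : ℝ) := by
    simp only [dctEntry, if_true, Nat.cast_zero, mul_zero, zero_mul, Real.cos_zero, mul_one]
    have h1 : √2 * √2 = (2 : ℝ) := Real.mul_self_sqrt (by norm_num)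
    have h2 : √(2 / ((N + 1 : ℕ) : ℝ)) * √(2 / ((N + 1 : ℕ) : ℝ)) = 2 / ((N + 1 : ℕ) : ℝ) :=
      Real.mul_self_sqrt (by positivity)
    calc _ = (1 / (√2 * √2)) * (√(2 / ((N + 1 : ℕ) : ℝ)) * √(2 / ((N + 1 : ℕ) : ℝ))) := by
          field_simp
      _ = _ := by rw [h1, h2]; field_simp
  have e1 : ∀ k : ℕ, dctEntry (N + 1) (k + 1) n * dctEntry (N + 1) (k + 1) (n + d)
      = 1 / ((N + 1 : ℕ) : ℝ) * (Real.cos (((k + 1 : ℕ) : ℝ) * (Real.pi / ((N + 1 : ℕ) : ℝ) * (d : ℕ)))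
        + Real.cos (((k + 1 : ℕ) : ℝ) * (Real.pi / ((N + 1 : ℕ) : ℝ) * ((2 * n + d + 1 : ℕ) : ℝ)))) := by
    intro k
    have h2 : √(2 / ((N + 1 : ℕ) : ℝ)) * √(2 / ((N + 1 : ℕ) : ℝ)) = 2 / ((N + 1 : ℕ) : ℝ) :=
      Real.mul_self_sqrt (by positivity)
    simp only [dctEntry, Nat.succ_ne_zero, if_false, one_mul]
    set A := Real.pi / ((N + 1 : ℕ) : ℝ) * ((k + 1 : ℕ) : ℝ) * ((n + d : ℕ) + 1 / 2) with hA
    set B := Real.pi / ((N + 1 : ℕ) : ℝ) * ((k + 1 : ℕ) : ℝ) * (n + 1 / 2) with hB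
    have h3 : ((k + 1 : ℕ) : ℝ) * (Real.pi / ((N + 1 : ℕ) : ℝ) * (d : ℕ)) = A - B := by
      rw [hA, hB]; push_cast; ring
    have h4 : ((k + 1 : ℕ) : ℝ) * (Real.pi / ((N + 1 : ℕ) : ℝ) * ((2 * n + d + 1 : ℕ) : ℝ)) = A + B := by
      rw [hA, hB]; push_cast; ring
    rw [h3, h4, Real.cos_sub, Real.cos_add]
    linear_combination (Real.cos A * Real.cos B) * h2
  rw [e0, Finset.sum_congr rfl (fun k _ => e1 k), ← Finset.mul_sum, Finset.sum_add_distrib]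
  ring

lemma dadcf_ss (N n d : ℕ) : ∑ k ∈ Finset.range (N + 1), dstEntry (N + 1) k n * dstEntry (N + 1) k (n + d)
    = 1 / ((N + 1 : ℕ) : ℝ) * ((-1) ^ d + 1 / 2 * (1 + 2 * ∑ k ∈ Finset.range N,
      Real.cos (((k + 1 : ℕ) : ℝ) * (Real.pi / ((N + 1 : ℕ) : ℝ) * (d : ℕ))))
      - 1 / 2 * (1 + 2 * ∑ k ∈ Finset.range N,
      Real.cos (((k + 1 : ℕ) : ℝ) * (Real.pi / ((N + 1 : ℕ) : ℝ) * ((2 * n + d + 1 : ℕ) : ℝ))))) := by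
  have hM : (0 : ℝ) < ((N + 1 : ℕ) : ℝ) := by positivity
  rw [Finset.sum_range_succ']
  have e0 : dstEntry (N + 1) 0 n * dstEntry (N + 1) 0 (n + d) = 1 / ((N + 1 : ℕ) : ℝ) * (-1) ^ d := by
    simp only [dstEntry, if_true, dadcf_sin_half]
    have h2 : √(1 / ((N + 1 : ℕ) : ℝ)) * √(1 / ((N + 1 : ℕ) : ℝ)) = 1 / ((N + 1 : ℕ) : ℝ) :=
      Real.mul_self_sqrt (by positivity)
    have h5 : ((-1 : ℝ) ^ n) * (-1) ^ n = 1 := by rw [← mul_pow]; norm_num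
    rw [pow_add]
    linear_combination ((-1 : ℝ) ^ n * (-1) ^ n * (-1) ^ d) * h2 + 1 / ((N + 1 : ℕ) : ℝ) * (-1) ^ d * h5
  have e1 : ∀ k : ℕ, dstEntry (N + 1) (k + 1) n * dstEntry (N + 1) (k + 1) (n + d)
      = 1 / ((N + 1 : ℕ) : ℝ) * (Real.cos (((k + 1 : ℕ) : ℝ) * (Real.pi / ((N + 1 : ℕ) : ℝ) * (d : ℕ)))
        - Real.cos (((k + 1 : ℕ) : ℝ) * (Real.pi / ((N + 1 : ℕ) : ℝ) * ((2 * n + d + 1 : ℕ) : ℝ)))) := by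
    intro k
    have h2 : √(2 / ((N + 1 : ℕ) : ℝ)) * √(2 / ((N + 1 : ℕ) : ℝ)) = 2 / ((N + 1 : ℕ) : ℝ) :=
      Real.mul_self_sqrt (by positivity)
    simp only [dstEntry, Nat.succ_ne_zero, if_false]
    set A := Real.pi / ((N + 1 : ℕ) : ℝ) * ((k + 1 : ℕ) : ℝ) * ((n + d : ℕ) + 1 / 2) with hA
    set B := Real.pi / ((N + 1 : ℕ) : ℝ) * ((k + 1 : ℕ) : ℝ) * (n + 1 / 2) with hB
    have h3 : ((k + 1 : ℕ) : ℝ) * (Real.pi / ((N + 1 : ℕ) : ℝ) * (d : ℕ)) = A - B := by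
      rw [hA, hB]; push_cast; ring
    have h4 : ((k + 1 : ℕ) : ℝ) * (Real.pi / ((N + 1 : ℕ) : ℝ) * ((2 * n + d + 1 : ℕ) : ℝ)) = A + B := by
      rw [hA, hB]; push_cast; ring
    rw [h3, h4, Real.cos_sub, Real.cos_add]
    linear_combination (Real.sin A * Real.sin B) * h2
  rw [e0, Finset.sum_congr rfl (fun k _ => e1 k), ← Finset.mul_sum, Finset.sum_sub_distrib]
  ring

lemma dadcf_pow_odd (n d : ℕ) : (-1 : ℝ) ^ (2 * n + d + 1) = - (-1) ^ d := by
  rw [pow_succ, pow_add, pow_mul]; norm_num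

lemma dadcf_cc' (N n d : ℕ) (h : n + d < N + 1) :
    ∑ k ∈ Finset.range (N + 1), dctEntry (N + 1) k n * dctEntry (N + 1) k (n + d)
      = if d = 0 then 1 else 0 := by
  have hM : ((N + 1 : ℕ) : ℝ) ≠ 0 := by positivity
  rw [dadcf_cc, dadcf_D N (2 * n + d + 1) (by omega) (by omega), dadcf_pow_odd]
  split_ifs with hd
  · subst hd
    rw [dadcf_D0]; field_simp; push_cast; ring
  · rw [dadcf_D N d (by omega) (by omega)]; ring

lemma dadcf_ss' (N n d : ℕ) (h : n + d < N + 1) :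
    ∑ k ∈ Finset.range (N + 1), dstEntry (N + 1) k n * dstEntry (N + 1) k (n + d)
      = if d = 0 then 1 else 0 := by
  have hM : ((N + 1 : ℕ) : ℝ) ≠ 0 := by positivity
  rw [dadcf_ss, dadcf_D N (2 * n + d + 1) (by omega) (by omega), dadcf_pow_odd]
  split_ifs with hd
  · subst hd
    rw [dadcf_D0]; field_simp; push_cast; ring
  · rw [dadcf_D N d (by omega) (by omega)]; ring

lemma dadcf_symm (f : ℕ → ℕ → ℝ) (M : ℕ)
    (h : ∀ n d, n + d < M → ∑ k ∈ Finset.range M, f k n * f k (n + d) = if d = 0 then 1 else 0)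
    (n m : ℕ) (hn : n < M) (hm : m < M) :
    ∑ k ∈ Finset.range M, f k n * f k m = if n = m then 1 else 0 := by
  rcases le_total n m with hnm | hnm
  · obtain ⟨d, rfl⟩ := Nat.exists_eq_add_of_le hnm
    rw [h n d hm]; simp
  · obtain ⟨d, rfl⟩ := Nat.exists_eq_add_of_le hnm
    rw [Finset.sum_congr rfl (fun k _ => mul_comm _ _), h m d hn]; simp

lemma dadcf_prod (g h : ℕ → ℝ) (M K : ℕ) (hM : 0 < M) :
    ∑ r ∈ Finset.range (K * M), g (r / M) * h (r % M)
      = (∑ q ∈ Finset.range K, g q) * ∑ t ∈ Finset.range M, h t := by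
  induction K with
  | zero => simp
  | succ K ih =>
    rw [Nat.succ_mul, Finset.sum_range_add, ih, Finset.sum_range_succ, add_mul, Finset.mul_sum]
    congr 1
    rw [Finset.mul_sum]
    refine Finset.sum_congr rfl fun t ht => ?_
    have ht' := Finset.mem_range.1 ht
    rw [Nat.mul_comm K M, Nat.mul_add_div hM, Nat.mul_add_mod, Nat.div_eq_of_lt ht',
      Nat.mod_eq_of_lt ht', add_zero]

lemma dadcf_kron (f : ℕ → ℕ → ℝ) (M : ℕ) (hM : 0 < M)
    (h : ∀ n m, n < M → m < M → ∑ k ∈ Finset.range M, f k n * f k m = if n = m then 1 else 0)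
    (p q : ℕ) (hp : p < M ^ 2) (hq : q < M ^ 2) :
    ∑ r ∈ Finset.range (M ^ 2), kron2 f M r p * kron2 f M r q = if p = q then 1 else 0 := by
  have e : ∀ r ∈ Finset.range (M ^ 2), kron2 f M r p * kron2 f M r q
      = (fun k => f k (p / M) * f k (q / M)) (r / M) *
        (fun k => f k (p % M) * f k (q % M)) (r % M) := by
    intro r _; simp only [kron2]; ring
  rw [Finset.sum_congr rfl e, pow_two, dadcf_prod (fun k => f k (p / M) * f k (q / M)) (fun k => f k (p % M) * f k (q % M)) M M hM]
  rw [pow_two] at hp hq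
  rw [h _ _ (Nat.div_lt_of_lt_mul hp) (Nat.div_lt_of_lt_mul hq),
    h _ _ (Nat.mod_lt _ hM) (Nat.mod_lt _ hM)]
  by_cases hpq : p = q
  · simp [hpq]
  · have : ¬ (p / M = q / M ∧ p % M = q % M) := by
      rintro ⟨h1, h2⟩
      apply hpq
      rw [← Nat.div_add_mod p M, ← Nat.div_add_mod q M, h1, h2]
    simp only [hpq, if_false]
    by_cases h1 : p / M = q / M
    · have h2 : p % M ≠ q % M := fun h2 => this ⟨h1, h2⟩
      simp [h2]
    · simp [h1]

lemma dadcf_stack (M : ℕ) (hM : 0 < M) : (dadcfStack M)ᵀ * dadcfStack M = (2 : ℝ) • 1 := by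
  obtain ⟨N, rfl⟩ : ∃ N, M = N + 1 := ⟨M - 1, by omega⟩
  ext p q
  rw [Matrix.mul_apply]
  simp only [Matrix.transpose_apply, dadcfStack, Matrix.of_apply]
  rw [Fin.sum_univ_eq_sum_range (fun i => (if i < (N + 1) ^ 2 then kron2 (dctEntry (N + 1)) (N + 1) i p
    else kron2 (dstEntry (N + 1)) (N + 1) (i - (N + 1) ^ 2) p) *
    (if i < (N + 1) ^ 2 then kron2 (dctEntry (N + 1)) (N + 1) i q
    else kron2 (dstEntry (N + 1)) (N + 1) (i - (N + 1) ^ 2) q)), two_mul, Finset.sum_range_add]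
  have hc := dadcf_kron (dctEntry (N + 1)) (N + 1) hM
    (dadcf_symm _ _ (fun n d h => dadcf_cc' N n d h)) p q p.2 q.2
  have hs := dadcf_kron (dstEntry (N + 1)) (N + 1) hM
    (dadcf_symm _ _ (fun n d h => dadcf_ss' N n d h)) p q p.2 q.2
  have e1 : ∀ i ∈ Finset.range ((N + 1) ^ 2),
      (if i < (N + 1) ^ 2 then kron2 (dctEntry (N + 1)) (N + 1) i p
    else kron2 (dstEntry (N + 1)) (N + 1) (i - (N + 1) ^ 2) p) *
    (if i < (N + 1) ^ 2 then kron2 (dctEntry (N + 1)) (N + 1) i q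
    else kron2 (dstEntry (N + 1)) (N + 1) (i - (N + 1) ^ 2) q) =
     kron2 (dctEntry (N + 1)) (N + 1) i p * kron2 (dctEntry (N + 1)) (N + 1) i q := by
    intro i hi
    rw [if_pos (Finset.mem_range.1 hi), if_pos (Finset.mem_range.1 hi)]
  rw [Finset.sum_congr rfl e1, hc]
  simp only [Nat.not_lt.2 (Nat.le_add_right _ _), if_false, Nat.add_sub_cancel_left]
  rw [hs, Matrix.smul_apply, Matrix.one_apply]
  simp only [Fin.ext_iff, smul_eq_mul]
  split_ifs <;> norm_num

/-- entries of `W` as a function of natural numbers -/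
noncomputable def dadcfWent (a b i j : ℕ) : ℝ :=
  if i < a then (if i = j then 1 / Real.sqrt 2 else 0)
    else if j < a then 0
    else
      (1 / 2) *
        (if i = j then 1
          else if i - a + b = j - a then -1
          else if i - a = j - a + b then 1
          else 0)

lemma dadcf_Wsum (a b p q : ℕ) (hb : 0 < b) (hp : p < a + 2 * b) (hq : q < a + 2 * b) :
    ∑ i ∈ Finset.range (a + 2 * b), dadcfWent a b i p * dadcfWent a b i q
      = if p = q then 1 / 2 else 0 := by
  have h2 : (1 / √2) * (1 / √2) = (1 / 2 : ℝ) := by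
    rw [div_mul_div_comm, Real.mul_self_sqrt (by norm_num)]; norm_num
  rcases lt_or_ge p a with h | h
  · have e : ∀ i, dadcfWent a b i p = if i = p then 1 / √2 else 0 := by
      intro i; unfold dadcfWent; split_ifs <;> first | rfl | omega
    simp only [e, ite_mul, zero_mul, Finset.sum_ite_eq', Finset.mem_range, hp, if_true]
    unfold dadcfWent
    rw [if_pos h]
    split_ifs <;> simp [h2]
    all_goals simpa using h2
  · rcases lt_or_ge p (a + b) with h' | h'
    · have e : ∀ i, dadcfWent a b i p = (if i = p then 1 / 2 else 0) + (if i = p + b then 1 / 2 else 0) := by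
        intro i; unfold dadcfWent; split_ifs <;> first | omega | norm_num
      have hp' : p + b < a + 2 * b := by omega
      rw [Finset.sum_congr rfl (fun i _ => by rw [e])]
      simp only [add_mul, Finset.sum_add_distrib, ite_mul, zero_mul, Finset.sum_ite_eq', Finset.mem_range, hp, hp', if_true]
      unfold dadcfWent
      split_ifs <;> first | omega | norm_num
    · have e : ∀ i, i < a + 2 * b → dadcfWent a b i p
          = (if i = p then 1 / 2 else 0) + (if i = p - b then -1 / 2 else 0) := by
        intro i hi; unfold dadcfWent; split_ifs <;> first | omega | norm_num
      have hp' : p - b < a + 2 * b := by omega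
      rw [Finset.sum_congr rfl (fun i hi => by rw [e i (Finset.mem_range.1 hi)])]
      simp only [add_mul, Finset.sum_add_distrib, ite_mul, zero_mul, Finset.sum_ite_eq', Finset.mem_range, hp, hp', if_true]
      unfold dadcfWent
      split_ifs <;> first | omega | norm_num

lemma dadcf_W (M : ℕ) (hM : 2 ≤ M) : (dadcfW M)ᵀ * dadcfW M = (1 / 2 : ℝ) • 1 := by
  have hb : 0 < (M - 1) ^ 2 := by have : 0 < M - 1 := by omega
                                  positivity
  have hle : (M - 1) ^ 2 ≤ M ^ 2 := Nat.pow_le_pow_left (by omega) 2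
  ext p q
  rw [Matrix.mul_apply]
  have e : ∀ i j, dadcfW M i j = dadcfWent (2 * M ^ 2 - 2 * (M - 1) ^ 2) ((M - 1) ^ 2) i j := by
    intro i j; rfl
  have hs : 2 * M ^ 2 = (2 * M ^ 2 - 2 * (M - 1) ^ 2) + 2 * (M - 1) ^ 2 := by omega
  simp only [Matrix.transpose_apply, e]
  rw [Fin.sum_univ_eq_sum_range (fun i =>
    dadcfWent (2 * M ^ 2 - 2 * (M - 1) ^ 2) ((M - 1) ^ 2) i p *
    dadcfWent (2 * M ^ 2 - 2 * (M - 1) ^ 2) ((M - 1) ^ 2) i q)]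
  have := dadcf_Wsum (2 * M ^ 2 - 2 * (M - 1) ^ 2) ((M - 1) ^ 2) p q hb (by omega) (by omega)
  rw [← hs] at this
  rw [this, Matrix.smul_apply, Matrix.one_apply]
  simp [Fin.ext_iff]

/-- The DADCF analysis operator `F^D = Pᵀ W P [F^C⊗F^C ; F^S⊗F^S]` is a Parseval frame:
`(F^D)ᵀ F^D = I_{M²}`, for every permutation matrix `P`. -/
theorem dadcf_parseval (M : ℕ) (hM : 2 ≤ M) (σ : Equiv.Perm (Fin (2 * M ^ 2))) :
    ∀ P : Matrix (Fin (2 * M ^ 2)) (Fin (2 * M ^ 2)) ℝ,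
      P = Matrix.of (fun i j => if σ j = i then (1 : ℝ) else 0) →
      (Pᵀ * dadcfW M * P * dadcfStack M)ᵀ * (Pᵀ * dadcfW M * P * dadcfStack M) = 1 := by
  intro P hP
  have hPP : P * Pᵀ = 1 := by
    ext i j
    rw [Matrix.mul_apply]
    simp only [hP, Matrix.transpose_apply, Matrix.of_apply, Matrix.one_apply]
    rw [Equiv.sum_comp σ (fun k => (if k = i then (1 : ℝ) else 0) * (if k = j then (1 : ℝ) else 0))]
    simp [eq_comm]
  have hPP' : Pᵀ * P = 1 := mul_eq_one_comm.1 hPP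
  have hW := dadcf_W M hM
  have hS := dadcf_stack M (by omega)
  calc _ = (dadcfStack M)ᵀ * (Pᵀ * ((dadcfW M)ᵀ * ((P * Pᵀ) * dadcfW M)) * P) * dadcfStack M := by
        simp only [Matrix.transpose_mul, Matrix.transpose_transpose, Matrix.mul_assoc]
    _ = 1 := by
        rw [hPP, Matrix.one_mul, hW, Matrix.mul_smul, Matrix.mul_one, Matrix.smul_mul, hPP',
          Matrix.mul_smul, Matrix.mul_one, Matrix.smul_mul, hS, smul_smul]
        norm_num
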